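/- Let d ≥ 1 and T > 0. Let w, w̃ : ℝ^d → ℝ^d be continuously differentiable and bounded with bounded Jacobians, and assume w is odd, i.e. w(−r) = −w(r) for all r. Let ν : ℝ^d → ℝ be continuously differentiable. Let f : [0,T] × ℝ^d → ℝ be continuously differentiable with each f(t,·) a probability density, solving ∂_t f(t,x) + div_x((w∗f)(t,x) f(t,x)) = 0 pointwise, where (w∗f)(t,x) := ∫ w(x−y) f(t,y) dy. Let f̃ : [0,T] × ℝ^d → ℝ be continuously differentiable with f̃(0,·) = 0, and suppose there exists R > 0 with f(t,x) = f̃(t,x) = 0 whenever ‖x‖ ≥ R; assume f̃ solves the linearized equation ∂_t f̃(t,x) + div_x( (w∗f)(t,x) f̃(t,x) + (w∗f̃)(t,x) f(t,x) + (w̃∗f)(t,x) f(t,x) ) = 0 for all (t,x). Let g : [0,T] × ℝ^d → ℝ be twice continuously differentiable with bounded first and second derivatives, solving the adjoint equation ∂_t g(t,y) − ∫ ⟨w(y−x), ∇_x g(t,x)⟩ f(t,x) dx + ⟨(w∗f)(t,y), ∇_y g(t,y)⟩ = 0 for all (t,y), with g(T,y) = ν(y). Then ∫_{ℝ^d} ν(x)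 f̃(T,x) dx = ∫₀^T ∫_{ℝ^d} ∫_{ℝ^d} ⟨∇_x g(t,x), w̃(x−y)⟩ f(t,y) f(t,x) dy dx dt. -/

import Mathlib

open MeasureTheory Set
open scoped RealInnerProductSpace BigOperators

noncomputable section

/-- `Euc d` is the Euclidean space `ℝ^d`. -/
abbrev Euc (d : ℕ) := EuclideanSpace ℝ (Fin d)

/-- The divergence of a vector field on `ℝ^d`. -/
def vdiv {d : ℕ} (F : Euc d → Euc d) (x : Euc d) : ℝ :=
  ∑ i : Fin d, fderiv ℝ F x (EuclideanSpace.single i 1) i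


lemma aux_conv {d : ℕ} (φ : Euc d → ℝ) (w : Euc d → Euc d) (hφ : ContDiff ℝ 1 φ)
    (hc : HasCompactSupport φ) (hw : Continuous w) :
    ContDiff ℝ 1 (fun z => ∫ y, φ y • w (z - y)) :=
  hc.contDiff_convolution_left (ContinuousLinearMap.lsmul ℝ ℝ) hφ
    (hw.locallyIntegrable (μ := volume))

lemma aux_ibp {d : ℕ} (G : Euc d → ℝ) (F : Euc d → Euc d) (hG : ContDiff ℝ 1 G)
    (hF : ContDiff ℝ 1 F) (hc : HasCompactSupport F) :
    Integrable (fun x => G x * vdiv F x) ∧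
    (∫ x, G x * vdiv F x) = - ∫ x, ⟪gradient G x, F x⟫ := by
  have hFi : ∀ i : Fin d, ContDiff ℝ 1 (fun x => F x i) := fun i => by fun_prop
  have hci : ∀ i : Fin d, HasCompactSupport (fun x => F x i) := fun i =>
    hc.comp_left (g := fun v : Euc d => v i) rfl
  have hder : ∀ (i : Fin d) x v, fderiv ℝ F x v i = fderiv ℝ (fun x => F x i) x v := by
    intro i x v
    have h1 : HasFDerivAt (fun x => F x i)
        ((EuclideanSpace.proj (𝕜 := ℝ) i).comp (fderiv ℝ F x)) x :=
      (EuclideanSpace.proj (𝕜 := ℝ) i).hasFDerivAt.comp x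
        (hF.differentiable one_ne_zero x).hasFDerivAt
    rw [h1.fderiv]; rfl
  have hc1 : ∀ i : Fin d, Continuous
      (fun x => fderiv ℝ (fun x => F x i) x (EuclideanSpace.single i 1)) := fun i =>
    ((hFi i).continuous_fderiv one_ne_zero).clm_apply continuous_const
  have hc2 : ∀ i : Fin d, Continuous
      (fun x => fderiv ℝ G x (EuclideanSpace.single i 1)) := fun i =>
    (hG.continuous_fderiv one_ne_zero).clm_apply continuous_const
  have hI1 : ∀ i : Fin d, Integrable
      (fun x => G x * fderiv ℝ (fun x => F x i) x (EuclideanSpace.single i 1)) := fun i =>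
    (hG.continuous.mul (hc1 i)).integrable_of_hasCompactSupport
      (((hci i).fderiv_apply (𝕜 := ℝ) _).mul_left)
  have hI2 : ∀ i : Fin d, Integrable
      (fun x => fderiv ℝ G x (EuclideanSpace.single i 1) * F x i) := fun i =>
    ((hc2 i).mul (hFi i).continuous).integrable_of_hasCompactSupport ((hci i).mul_left)
  have hI3 : ∀ i : Fin d, Integrable (fun x => G x * F x i) := fun i =>
    (hG.continuous.mul (hFi i).continuous).integrable_of_hasCompactSupport ((hci i).mul_left)
  have e1 : (fun x => G x * vdiv F x) = fun x => ∑ i : Fin d,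
      G x * fderiv ℝ (fun x => F x i) x (EuclideanSpace.single i 1) := by
    funext x
    simp only [vdiv, Finset.mul_sum, hder]
  have e2 : (fun x => ⟪gradient G x, F x⟫) = fun x => ∑ i : Fin d,
      fderiv ℝ G x (EuclideanSpace.single i 1) * F x i := by
    funext x
    have h : ⟪gradient G x, F x⟫ = fderiv ℝ G x (F x) := by
      simp [gradient]
    have h2 : F x = ∑ i : Fin d, F x i • EuclideanSpace.single i (1:ℝ) := by
      ext j
      simp [Finset.sum_apply, Pi.single_apply]
    rw [h]
    conv_lhs => rw [h2]
    simp [map_sum, mul_comm]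
  refine ⟨?_, ?_⟩
  · rw [e1]; exact integrable_finsetSum _ fun i _ => hI1 i
  · rw [e1, e2, integral_finsetSum _ fun i _ => hI1 i, integral_finsetSum _ fun i _ => hI2 i,
      ← Finset.sum_neg_distrib]
    refine Finset.sum_congr rfl fun i _ => ?_
    exact integral_mul_fderiv_eq_neg_fderiv_mul_of_integrable (hI2 i) (hI1 i) (hI3 i)
      (fun x _ => hG.differentiable one_ne_zero x)
      (fun x _ => (hFi i).differentiable one_ne_zero x)

lemma aux_key {d : ℕ} (w w' : Euc d → Euc d) (hw : Continuous w) (hw' : Continuous w')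
    (hwodd : ∀ r : Euc d, w (-r) = -w r) (φ ψ G G' D : Euc d → ℝ)
    (hφ : ContDiff ℝ 1 φ) (hψ : ContDiff ℝ 1 ψ) (hG : ContDiff ℝ 1 G)
    (cφ : HasCompactSupport φ) (cψ : HasCompactSupport ψ)
    (hD : ∀ x, D x + vdiv (fun z => ψ z • (∫ y, φ y • w (z - y))
            + φ z • (∫ y, ψ y • w (z - y)) + φ z • (∫ y, φ y • w' (z - y))) x = 0)
    (hG' : ∀ y, G' y - (∫ x, ⟪w (y - x), gradient G x⟫ * φ x)
        + ⟪(∫ x, φ x • w (y - x)), gradient G y⟫ = 0) :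
    (∫ x, (G' x * ψ x + G x * D x)) =
      ∫ x, ∫ y, ⟪gradient G x, w' (x - y)⟫ * φ y * φ x := by
  have hgr : Continuous (gradient G) := by
    unfold gradient
    exact (LinearIsometryEquiv.continuous _).comp (hG.continuous_fderiv one_ne_zero)
  have hA := aux_conv φ w hφ cφ hw
  have hB := aux_conv ψ w hψ cψ hw
  have hC := aux_conv φ w' hφ cφ hw'
  have pull : ∀ (χ : Euc d → ℝ) (u : Euc d → Euc d) (x : Euc d), Continuous χ →
      HasCompactSupport χ → Continuous u →
      (∫ y, ⟪gradient G x, u (x - y)⟫ * χ y) = ⟪gradient G x, ∫ y, χ y • u (x - y)⟫ := by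
    intro χ u x h1 h2 h3
    rw [← integral_inner]
    · refine integral_congr_ae (Filter.Eventually.of_forall fun y => ?_)
      simp only [inner_smul_right]; ring
    · exact Continuous.integrable_of_hasCompactSupport (by fun_prop) h2.smul_right
  have pB := fun x => pull ψ w x hψ.continuous cψ hw
  have pC := fun x => pull φ w' x hφ.continuous cφ hw'
  set A : Euc d → Euc d := fun z => ∫ y, φ y • w (z - y) with hAdef
  set B : Euc d → Euc d := fun z => ∫ y, ψ y • w (z - y) with hBdef
  set C : Euc d → Euc d := fun z => ∫ y, φ y • w' (z - y) with hCdef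
  set S : Euc d → ℝ := fun y => ∫ x, ⟪w (y - x), gradient G x⟫ * φ x with hS
  set F : Euc d → Euc d := fun z => ψ z • A z + φ z • B z + φ z • C z with hFdef
  have hF : ContDiff ℝ 1 F := ((hψ.smul hA).add (hφ.smul hB)).add (hφ.smul hC)
  have cF : HasCompactSupport F := (cψ.smul_right.add cφ.smul_right).add cφ.smul_right
  obtain ⟨i1, ibp⟩ := aux_ibp G F hG hF cF
  have hAc := hA.continuous
  have hBc := hB.continuous
  have hCc := hC.continuous
  have hφc := hφ.continuous
  have hψc := hψ.continuous
  -- the double integrand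
  let K : Euc d → Euc d → ℝ := fun y x => ⟪w (y - x), gradient G x⟫ * φ x * ψ y
  have hKc : Continuous (Function.uncurry K) := by
    simp only [K, Function.uncurry_def]; fun_prop
  have hKs : HasCompactSupport (Function.uncurry K) := by
    refine HasCompactSupport.intro (IsCompact.prod cψ cφ) ?_
    rintro ⟨y, x⟩ h
    simp only [mem_prod, not_and_or] at h
    simp only [K, Function.uncurry_apply_pair]
    rcases h with h | h
    · rw [image_eq_zero_of_notMem_tsupport h]; simp
    · rw [image_eq_zero_of_notMem_tsupport h]; simp
  have hKi : Integrable (Function.uncurry K) (volume.prod volume) :=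
    hKc.integrable_of_hasCompactSupport hKs
  have eS : ∀ y, S y * ψ y = ∫ x, K y x := fun y => (integral_mul_const _ _).symm
  have iS : Integrable (fun y => S y * ψ y) := by
    simp_rw [eS]; exact hKi.integral_prod_left
  have iA : Integrable (fun x => ψ x * ⟪gradient G x, A x⟫) :=
    Continuous.integrable_of_hasCompactSupport (by fun_prop) cψ.mul_right
  have iB : Integrable (fun x => φ x * ⟪gradient G x, B x⟫) :=
    Continuous.integrable_of_hasCompactSupport (by fun_prop) cφ.mul_right
  have iC : Integrable (fun x => φ x * ⟪gradient G x, C x⟫) :=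
    Continuous.integrable_of_hasCompactSupport (by fun_prop) cφ.mul_right
  have iAB : Integrable (fun x => ψ x * ⟪gradient G x, A x⟫ + φ x * ⟪gradient G x, B x⟫) :=
    iA.add iB
  have iSA : Integrable (fun x => S x * ψ x - ψ x * ⟪gradient G x, A x⟫) := iS.sub iA
  have sS : (∫ y, S y * ψ y) = - ∫ x, φ x * ⟪gradient G x, B x⟫ := by
    simp_rw [eS]
    rw [integral_integral_swap hKi, ← integral_neg]
    refine integral_congr_ae (Filter.Eventually.of_forall fun x => ?_)
    simp only
    rw [← pB x, ← integral_const_mul, ← integral_neg]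
    refine integral_congr_ae (Filter.Eventually.of_forall fun y => ?_)
    simp only [K]
    rw [← neg_sub x y, hwodd, inner_neg_left, real_inner_comm]; ring
  have eF : (∫ x, ⟪gradient G x, F x⟫) = (∫ x, ψ x * ⟪gradient G x, A x⟫)
      + (∫ x, φ x * ⟪gradient G x, B x⟫) + ∫ x, φ x * ⟪gradient G x, C x⟫ := by
    rw [← integral_add iA iB, ← integral_add iAB iC]
    refine integral_congr_ae (Filter.Eventually.of_forall fun x => ?_)
    simp only [hFdef, inner_add_right, inner_smul_right, Pi.add_apply]
  have e0 : (fun x => G' x * ψ x + G x * D x) =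
      fun x => S x * ψ x - ψ x * ⟪gradient G x, A x⟫ - G x * vdiv F x := by
    funext x
    have h1 := hD x
    have h2 := hG' x
    have h3 : D x = - vdiv F x := by linarith
    have h4 : G' x = S x - ⟪gradient G x, A x⟫ := by
      rw [real_inner_comm]; linarith
    rw [h3, h4]; ring
  have eR : (∫ x, ∫ y, ⟪gradient G x, w' (x - y)⟫ * φ y * φ x)
      = ∫ x, φ x * ⟪gradient G x, C x⟫ := by
    refine integral_congr_ae (Filter.Eventually.of_forall fun x => ?_)
    simp only
    rw [integral_mul_const, pC x, mul_comm]
  rw [eR, e0, integral_sub iSA i1, integral_sub iS iA, ibp, eF, sS]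
  ring

lemma aux_deriv {d : ℕ} (f : ℝ → Euc d → ℝ)
    (hf : ContDiff ℝ 1 (fun p : ℝ × Euc d => f p.1 p.2)) :
    (∀ t x, HasDerivAt (fun s => f s x) (deriv (fun s => f s x) t) t) ∧
    Continuous (fun p : ℝ × Euc d => deriv (fun s => f s p.2) p.1) := by
  have h : ∀ t x, HasDerivAt (fun s => f s x)
      (fderiv ℝ (fun p : ℝ × Euc d => f p.1 p.2) (t, x) (1, 0)) t := by
    intro t x
    have h1 := (hf.differentiable one_ne_zero (t, x)).hasFDerivAt
    have h2 : HasDerivAt (fun s : ℝ => (s, x)) ((1 : ℝ), (0 : Euc d)) t :=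
      (hasDerivAt_id t).prodMk (hasDerivAt_const t x)
    exact h1.comp_hasDerivAt t h2
  refine ⟨fun t x => (h t x).differentiableAt.hasDerivAt, ?_⟩
  have e : (fun p : ℝ × Euc d => deriv (fun s => f s p.2) p.1) =
      fun p => fderiv ℝ (fun p : ℝ × Euc d => f p.1 p.2) p (1, 0) := by
    funext p; exact (h p.1 p.2).deriv
  rw [e]
  exact (hf.continuous_fderiv one_ne_zero).clm_apply continuous_const

/-- (Duality content of Lemma 3.5.) For the mean-field equation
`∂ₜ f + ∇·((w∗f) f) = 0` and measurement `∫ ν f(T)`, the derivative of the objective in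
the direction of a kernel perturbation `w'`, represented by the solution `f'` of the
linearized equation, equals the triple integral involving the adjoint state `g`. -/
theorem meanfield_first_variation_duality
    (d : ℕ) (hd : 1 ≤ d) (T : ℝ) (hT : 0 < T)
    (w w' : Euc d → Euc d)
    (hw : ContDiff ℝ 1 w) (hw' : ContDiff ℝ 1 w')
    (hwb : ∃ C, ∀ r : Euc d, ‖w r‖ ≤ C ∧ ‖fderiv ℝ w r‖ ≤ C)
    (hw'b : ∃ C, ∀ r : Euc d, ‖w' r‖ ≤ C ∧ ‖fderiv ℝ w' r‖ ≤ C)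
    (hwodd : ∀ r : Euc d, w (-r) = -w r)
    (ν : Euc d → ℝ) (hν : ContDiff ℝ 1 ν)
    (f : ℝ → Euc d → ℝ)
    (hf : ContDiff ℝ 1 (fun p : ℝ × Euc d => f p.1 p.2))
    (hfprob : ∀ t ∈ Icc (0 : ℝ) T, (∀ x : Euc d, 0 ≤ f t x) ∧ (∫ x, f t x) = 1)
    (hfPDE : ∀ t ∈ Icc (0 : ℝ) T, ∀ x : Euc d,
      deriv (fun s => f s x) t
        + vdiv (fun z => f t z • (∫ y, f t y • w (z - y))) x = 0)
    (f' : ℝ → Euc d → ℝ)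
    (hf' : ContDiff ℝ 1 (fun p : ℝ × Euc d => f' p.1 p.2))
    (hf'0 : ∀ x : Euc d, f' 0 x = 0)
    (hsupp : ∃ R > 0, ∀ t ∈ Icc (0 : ℝ) T, ∀ x : Euc d, R ≤ ‖x‖ →
      f t x = 0 ∧ f' t x = 0)
    (hf'PDE : ∀ t ∈ Icc (0 : ℝ) T, ∀ x : Euc d,
      deriv (fun s => f' s x) t
        + vdiv (fun z =>
            f' t z • (∫ y, f t y • w (z - y))
            + f t z • (∫ y, f' t y • w (z - y))
            + f t z • (∫ y, f t y • w' (z - y))) x = 0)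
    (g : ℝ → Euc d → ℝ)
    (hg : ContDiff ℝ 2 (fun p : ℝ × Euc d => g p.1 p.2))
    (hgb : ∃ C, ∀ t ∈ Icc (0 : ℝ) T, ∀ x : Euc d,
      ‖gradient (g t) x‖ ≤ C ∧ ‖fderiv ℝ (fun y => gradient (g t) y) x‖ ≤ C)
    (hgPDE : ∀ t ∈ Icc (0 : ℝ) T, ∀ y : Euc d,
      deriv (fun s => g s y) t
        - (∫ x, ⟪w (y - x), gradient (g t) x⟫ * f t x)
        + ⟪(∫ x, f t x • w (y - x)), gradient (g t) y⟫ = 0)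
    (hgT : ∀ y : Euc d, g T y = ν y) :
    (∫ x, ν x * f' T x)
      = ∫ t in (0 : ℝ)..T, ∫ x,
          ∫ y, ⟪gradient (g t) x, w' (x - y)⟫ * f t y * f t x := by
  obtain ⟨R, hR, hs⟩ := hsupp
  obtain ⟨df, cf⟩ := aux_deriv f' hf'
  have hg1 : ContDiff ℝ 1 (fun p : ℝ × Euc d => g p.1 p.2) := hg.of_le (by norm_num)
  obtain ⟨dg, cg⟩ := aux_deriv g hg1
  have hsl : ∀ (h : ℝ → Euc d → ℝ), ContDiff ℝ 1 (fun p : ℝ × Euc d => h p.1 p.2) →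
      ∀ t, ContDiff ℝ 1 (h t) := fun h hh t =>
    hh.comp (contDiff_const.prodMk contDiff_id : ContDiff ℝ 1 (fun x : Euc d => (t, x)))
  let H : ℝ → Euc d → ℝ := fun t x =>
    deriv (fun s => g s x) t * f' t x + g t x * deriv (fun s => f' s x) t
  have hHc : Continuous (Function.uncurry H) := by
    have h1 := hf'.continuous
    have h2 := hg.continuous
    exact (cg.mul h1).add (h2.mul cf)
  have ftc : ∀ x, (∫ t in (0:ℝ)..T, H t x) = ν x * f' T x := by
    intro x
    have hc : Continuous (fun t => H t x) :=
      hHc.comp (continuous_id.prodMk continuous_const)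
    rw [intervalIntegral.integral_eq_sub_of_hasDerivAt (f := fun t => g t x * f' t x)
      (fun t _ => (dg t x).mul (df t x)) (hc.intervalIntegrable _ _)]
    simp [hf'0, hgT]
  have hTmem : T ∈ Icc (0:ℝ) T := ⟨hT.le, le_rfl⟩
  have step1 : (∫ x, ν x * f' T x) = ∫ x in Metric.closedBall (0 : Euc d) R, ν x * f' T x := by
    symm
    refine setIntegral_eq_integral_of_forall_compl_eq_zero fun x hx => ?_
    have : R ≤ ‖x‖ := by
      simp only [Metric.mem_closedBall, dist_zero_right, not_le] at hx; exact hx.le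
    rw [(hs T hTmem x this).2, mul_zero]
  rw [step1]
  simp_rw [← ftc]
  have swap : (∫ x in Metric.closedBall (0 : Euc d) R, ∫ t in (0:ℝ)..T, H t x)
      = ∫ t in (0:ℝ)..T, ∫ x in Metric.closedBall (0 : Euc d) R, H t x := by
    simp only [intervalIntegral.integral_of_le hT.le]
    symm
    refine integral_integral_swap ?_
    rw [Measure.prod_restrict]
    refine IntegrableOn.mono_set (t := Icc 0 T ×ˢ Metric.closedBall (0 : Euc d) R) ?_
      (prod_mono Ioc_subset_Icc_self le_rfl)
    exact hHc.continuousOn.integrableOn_compact (isCompact_Icc.prod (isCompact_closedBall _ _))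
  rw [swap]
  refine intervalIntegral.integral_congr fun t ht => ?_
  rw [uIcc_of_le hT.le] at ht
  have cs : ∀ h : Euc d → ℝ, (∀ x, R ≤ ‖x‖ → h x = 0) → HasCompactSupport h := by
    intro h hh
    refine HasCompactSupport.intro (isCompact_closedBall (0 : Euc d) R) fun x hx => hh x ?_
    simp only [Metric.mem_closedBall, dist_zero_right, not_le] at hx; exact hx.le
  rw [setIntegral_eq_integral_of_forall_compl_eq_zero]
  · exact aux_key w w' hw.continuous hw'.continuous hwodd (f t) (f' t) (g t) _ _
      (hsl f hf t) (hsl f' hf' t) (hsl g hg1 t) (cs _ fun x hx => (hs t ht x hx).1)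
      (cs _ fun x hx => (hs t ht x hx).2) (hf'PDE t ht) (hgPDE t ht)
  · intro x hx
    simp only [Metric.mem_closedBall, dist_zero_right, not_le] at hx
    have h1 := hf'PDE t ht x
    have h2 : vdiv (fun z =>
            f' t z • (∫ y, f t y • w (z - y))
            + f t z • (∫ y, f' t y • w (z - y))
            + f t z • (∫ y, f t y • w' (z - y))) x = 0 := by
      have : (fun z =>
            f' t z • (∫ y, f t y • w (z - y))
            + f t z • (∫ y, f' t y • w (z - y))
            + f t z • (∫ y, f t y • w' (z - y))) =ᶠ[nhds x] fun _ => (0 : Euc d) := by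
        filter_upwards [continuous_norm.continuousAt.eventually (lt_mem_nhds hx)] with z hz
        simp [hs t ht z hz.le]
      simp only [vdiv, this.fderiv_eq]
      simp
    rw [h2, add_zero] at h1
    simp only [H, h1, (hs t ht x hx.le).2]
    simp
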